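/- Let f, g ∈ ℂ[x, y] be nonconstant squarefree polynomials in two variables. If the affine plane curves V(f) ⊆ ℂ² and V(g) ⊆ ℂ² are outer bi-Lipschitz homeomorphic at infinity, then the total degree of f equals the total degree of g. -/

import Mathlib

open Filter Topology MvPolynomial

/-- The tangent cone at infinity of a subset `A` of a normed space: `v` is a tangent
vector at infinity if there are points `x i ∈ A` with `‖x i‖ → ∞` and positive reals
`t i` with `x i / t i → v`. -/
def TangentConeAtInfty {E : Type*} [NormedAddCommGroup E] [NormedSpace ℝ E]
    (A : Set E) : Set E :=
  {v | ∃ (x : ℕ → E) (t : ℕ → ℝ), (∀ i, x i ∈ A) ∧ (∀ i, 0 < t i) ∧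
    Tendsto (fun i => ‖x i‖) atTop atTop ∧
    Tendsto (fun i => (t i)⁻¹ • x i) atTop (𝓝 v)}

/-- `X` and `Y` are outer bi-Lipschitz homeomorphic at infinity: there are compact sets
`K`, `K'` and a bijection `φ : X \ K → Y \ K'` which is Lipschitz with Lipschitz inverse,
with respect to the Euclidean (outer) distance. -/
def OuterBiLipAtInfty {E F : Type*} [NormedAddCommGroup E] [NormedAddCommGroup F]
    (X : Set E) (Y : Set F) : Prop :=
  ∃ (K : Set E) (K' : Set F) (φ : E → F),
    IsCompact K ∧ IsCompact K' ∧ Set.BijOn φ (X \ K) (Y \ K') ∧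
    (∃ C > (0:ℝ), ∀ a ∈ X \ K, ∀ b ∈ X \ K, dist (φ a) (φ b) ≤ C * dist a b) ∧
    (∃ c > (0:ℝ), ∀ a ∈ X \ K, ∀ b ∈ X \ K, dist a b ≤ c * dist (φ a) (φ b))

/-- The germs `(X,0)` and `(Y,0)` are outer bi-Lipschitz homeomorphic: there are
`ε, δ > 0` and a bijection `φ : X ∩ B̄_ε(0) → Y ∩ B̄_δ(0)` with `φ 0 = 0` which is
Lipschitz with Lipschitz inverse for the Euclidean (outer) distance. -/
def OuterBiLipGerm {E F : Type*} [NormedAddCommGroup E] [NormedAddCommGroup F]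
    (X : Set E) (Y : Set F) : Prop :=
  ∃ ε > (0:ℝ), ∃ δ > (0:ℝ), ∃ φ : E → F,
    Set.BijOn φ (X ∩ Metric.closedBall 0 ε) (Y ∩ Metric.closedBall 0 δ) ∧ φ 0 = 0 ∧
    (∃ C > (0:ℝ), ∀ a ∈ X ∩ Metric.closedBall 0 ε, ∀ b ∈ X ∩ Metric.closedBall 0 ε,
      dist (φ a) (φ b) ≤ C * dist a b) ∧
    (∃ c > (0:ℝ), ∀ a ∈ X ∩ Metric.closedBall 0 ε, ∀ b ∈ X ∩ Metric.closedBall 0 ε,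
      dist a b ≤ c * dist (φ a) (φ b))

/-- The zero set in `ℂⁿ` (with the Euclidean norm) of a polynomial. -/
noncomputable def mvZeroSet {n : ℕ} (f : MvPolynomial (Fin n) ℂ) :
    Set (EuclideanSpace ℂ (Fin n)) :=
  {x | MvPolynomial.eval (x : Fin n → ℂ) f = 0}

/-- The set `X ⊆ ℂ²` is asymptotic at infinity to the lines `y = a x` with `a ∈ A`. -/
def AsymptoticToLines (X : Set (ℂ × ℂ)) (A : Finset ℂ) : Prop :=
  ∀ δ > (0 : ℝ), ∃ N : ℝ, ∀ p ∈ X, N ≤ ‖p‖ → ∃ a ∈ A, ‖p.2 - a * p.1‖ ≤ δ * ‖p‖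

theorem Finset.exists_norm_le (A : Finset ℂ) : ∃ B : ℝ, 0 ≤ B ∧ ∀ a ∈ A, ‖a‖ ≤ B :=
  ⟨∑ a ∈ A, ‖a‖, Finset.sum_nonneg fun _ _ => norm_nonneg _, fun _ ha =>
    Finset.single_le_sum (f := fun a => ‖a‖) (fun _ _ => norm_nonneg _) ha⟩

theorem Finset.exists_separation (A : Finset ℂ) :
    ∃ σ > (0 : ℝ), ∀ a ∈ A, ∀ b ∈ A, ‖a - b‖ < σ → a = b := by
  obtain h | h := (A.offDiag).eq_empty_or_nonempty
  · refine ⟨1, one_pos, fun a ha b hb _ => ?_⟩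
    by_contra hab
    have : (a, b) ∈ A.offDiag := Finset.mem_offDiag.2 ⟨ha, hb, hab⟩
    simp [h] at this
  · obtain ⟨q, hq, hmin⟩ := A.offDiag.exists_min_image (fun q => ‖q.1 - q.2‖) h
    refine ⟨‖q.1 - q.2‖, norm_pos_iff.2 (sub_ne_zero.2 (Finset.mem_offDiag.1 hq).2.2),
      fun a ha b hb hlt => ?_⟩
    by_contra hab
    exact (hmin (a, b) (Finset.mem_offDiag.2 ⟨ha, hb, hab⟩)).not_gt hlt

namespace AsymptoticToLines

variable {X : Set (ℂ × ℂ)} {A : Finset ℂ}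

theorem norm_le (h : AsymptoticToLines X A) :
    ∃ M : ℝ, 1 ≤ M ∧ ∃ N : ℝ, ∀ p ∈ X, N ≤ ‖p‖ → ‖p‖ ≤ M * ‖p.1‖ := by
  obtain ⟨B, hB0, hB⟩ := A.exists_norm_le
  obtain ⟨N, hN⟩ := h (1 / 2) (by norm_num)
  refine ⟨2 * B + 1, by linarith, N, fun p hp hpN => ?_⟩
  obtain ⟨a, ha, hle⟩ := hN p hp hpN
  have h1 : ‖p.2‖ ≤ ‖p.2 - a * p.1‖ + ‖a‖ * ‖p.1‖ := by
    simpa using norm_add_le (p.2 - a * p.1) (a * p.1)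
  have h2 : ‖a‖ * ‖p.1‖ ≤ B * ‖p.1‖ := by gcongr; exact hB a ha
  have h3 := mul_nonneg hB0 (norm_nonneg p.1)
  rcases le_total ‖p.1‖ ‖p.2‖ with hc | hc
  · have : ‖p‖ = ‖p.2‖ := by rw [Prod.norm_def, max_eq_right hc]
    nlinarith [norm_nonneg p.1]
  · have : ‖p‖ = ‖p.1‖ := by rw [Prod.norm_def, max_eq_left hc]
    nlinarith [norm_nonneg p.1]

theorem exists_slope (h : AsymptoticToLines X A) {η : ℝ} (hη : 0 < η) :
    ∃ N : ℝ, ∀ p ∈ X, N ≤ ‖p‖ → ∃ a ∈ A, ‖p.2 - a * p.1‖ ≤ η * ‖p.1‖ := by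
  obtain ⟨M, hM, N, hN⟩ := h.norm_le
  obtain ⟨N', hN'⟩ := h (η / M) (by positivity)
  refine ⟨max N N', fun p hp hpN => ?_⟩
  obtain ⟨a, ha, hle⟩ := hN' p hp ((le_max_right _ _).trans hpN)
  refine ⟨a, ha, hle.trans ?_⟩
  calc η / M * ‖p‖ ≤ η / M * (M * ‖p.1‖) := by
        gcongr; exact hN p hp ((le_max_left _ _).trans hpN)
    _ = η * ‖p.1‖ := by field_simp

theorem exists_common_slope (h : AsymptoticToLines X A) {η : ℝ} (hη : 0 < η) :
    ∃ N : ℝ, ∀ S ⊆ X, IsPreconnected S → S.Nonempty → (∀ p ∈ S, N ≤ ‖p‖) →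
      ∃ a ∈ A, ∀ p ∈ S, ‖p.2 - a * p.1‖ ≤ η * ‖p.1‖ := by
  obtain ⟨σ, hσ, hsep⟩ := A.exists_separation
  obtain ⟨M, hM, N₁, hN₁⟩ := h.norm_le
  set θ := min η (σ / 3) with hθ
  have hθ0 : 0 < θ := by positivity
  obtain ⟨N₂, hN₂⟩ := h.exists_slope hθ0
  refine ⟨max 1 (max N₁ N₂), fun S hSX hS ⟨p₀, hp₀⟩ hbig => ?_⟩
  have hfst : ∀ p ∈ S, 0 < ‖p.1‖ := fun p hp => by
    have h1 := hN₁ p (hSX hp) (((le_max_left _ _).trans (le_max_right _ _)).trans (hbig p hp))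
    have h2 := (le_max_left _ _).trans (hbig p hp)
    by_contra! h3
    nlinarith
  have hslope : ∀ p ∈ S, ∃ a ∈ A, ‖p.2 - a * p.1‖ ≤ θ * ‖p.1‖ := fun p hp =>
    hN₂ p (hSX hp) (((le_max_right _ _).trans (le_max_right _ _)).trans (hbig p hp))
  have hiff : ∀ p ∈ S, ∀ a : ℂ, ‖p.2 / p.1 - a‖ * ‖p.1‖ = ‖p.2 - a * p.1‖ := fun p hp a => by
    have : p.1 ≠ 0 := norm_pos_iff.1 (hfst p hp)
    rw [← norm_mul, sub_mul, div_mul_cancel₀ _ this]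
  have hball : ∀ p ∈ S, ∀ a : ℂ, ‖p.2 - a * p.1‖ ≤ θ * ‖p.1‖ ↔ ‖p.2 / p.1 - a‖ ≤ θ :=
    fun p hp a => by rw [← hiff p hp a, mul_le_mul_iff_left₀ (hfst p hp)]
  obtain ⟨a, ha, hpa⟩ := hslope p₀ hp₀
  have hT : IsPreconnected ((fun p : ℂ × ℂ => p.2 / p.1) '' S) :=
    hS.image _ (continuousOn_snd.div continuousOn_fst fun p hp => norm_pos_iff.1 (hfst p hp))
  have hθσ : θ ≤ σ / 3 := min_le_right _ _
  have hsub := isPreconnected_closed_iff.1 hT (Metric.closedBall a θ)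
    (⋃ b ∈ A.erase a, Metric.closedBall b θ) Metric.isClosed_closedBall
    (isClosed_biUnion_finset fun _ _ => Metric.isClosed_closedBall)
  refine ⟨a, ha, fun p hp => ?_⟩
  obtain ⟨b, hb, hpb⟩ := hslope p hp
  by_cases hab : b = a
  · subst hab
    exact hpb.trans (by gcongr; exact min_le_left _ _)
  exfalso
  have hcover : (fun p : ℂ × ℂ => p.2 / p.1) '' S ⊆
      Metric.closedBall a θ ∪ ⋃ b ∈ A.erase a, Metric.closedBall b θ := by
    rintro _ ⟨q, hq, rfl⟩
    obtain ⟨c, hc, hqc⟩ := hslope q hq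
    rw [hball q hq, ← dist_eq_norm] at hqc
    by_cases hca : c = a
    · subst hca; exact Or.inl hqc
    · exact Or.inr (Set.mem_biUnion (Finset.mem_coe.2 (Finset.mem_erase.2 ⟨hca, hc⟩)) hqc)
  rw [hball p₀ hp₀, ← dist_eq_norm] at hpa
  rw [hball p hp, ← dist_eq_norm] at hpb
  obtain ⟨w, -, hw1, hw2⟩ := hsub hcover ⟨_, ⟨p₀, hp₀, rfl⟩, hpa⟩ ⟨_, ⟨p, hp, rfl⟩,
    Set.mem_biUnion (Finset.mem_coe.2 (Finset.mem_erase.2 ⟨hab, hb⟩)) hpb⟩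
  simp only [Set.mem_iUnion] at hw2
  obtain ⟨c, hc, hwc⟩ := hw2
  rw [Finset.mem_erase] at hc
  refine hc.1 (hsep c hc.2 a ha ?_)
  rw [← dist_eq_norm]
  rw [Metric.mem_closedBall] at hw1 hwc
  have := dist_triangle_left c a w
  linarith

end AsymptoticToLines

/-- A description of `X ⊆ ℂ²` near infinity as a union of `d` pairwise disjoint graphs
over the logarithmic half-plane `re z > radius`, the base coordinate being `exp z`. -/
structure SheetSystem (X : Set (ℂ × ℂ)) (d : ℕ) where
  slopes : Finset ℂ
  asymptotic : AsymptoticToLines X slopes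
  radius : ℝ
  sheet : Fin d → ℂ → ℂ
  continuousOn_sheet : ∀ i, ContinuousOn (sheet i) {z | radius < z.re}
  sheet_injective : ∀ z : ℂ, radius < z.re → ∀ i j, sheet i z = sheet j z → i = j
  mem_iff : ∀ z : ℂ, radius < z.re → ∀ y, (Complex.exp z, y) ∈ X ↔ ∃ i, sheet i z = y

namespace SheetSystem

variable {X Y : Set (ℂ × ℂ)} {d e : ℕ}

theorem eq_of_isPreconnected (T : SheetSystem X d) {S : Set (ℂ × ℂ)} (hSX : S ⊆ X)
    (hS : IsPreconnected S) (hslit : ∀ p ∈ S, p.1 ∈ Complex.slitPlane)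
    (hbig : ∀ p ∈ S, T.radius < Real.log ‖p.1‖) {p q : ℂ × ℂ} (hp : p ∈ S) (hq : q ∈ S)
    (hpq : p.1 = q.1) : p = q := by
  have : PreconnectedSpace S := isPreconnected_iff_preconnectedSpace.1 hS
  have hre : ∀ p ∈ S, T.radius < (Complex.log p.1).re := fun p hp => by
    rw [Complex.log_re]; exact hbig p hp
  have hex : ∀ p : S, ∃ i, T.sheet i (Complex.log p.1.1) = p.1.2 := fun p => by
    rw [← T.mem_iff _ (hre p p.2), Complex.exp_log (Complex.slitPlane_ne_zero (hslit p p.2))]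
    exact hSX p.2
  let C : Fin d → Set S := fun i => {p | T.sheet i (Complex.log p.1.1) = p.1.2}
  have hclosed : ∀ i, IsClosed (C i) := fun i => by
    refine isClosed_eq ?_ (continuous_snd.comp continuous_subtype_val)
    refine (T.continuousOn_sheet i).comp_continuous ?_ fun p => hre p p.2
    exact (continuous_fst.comp continuous_subtype_val).clog fun p => hslit p p.2
  obtain ⟨i, hi⟩ := hex ⟨p, hp⟩
  have hcompl : (C i)ᶜ = ⋃ j ∈ ({i}ᶜ : Set (Fin d)), C j := by
    ext w
    simp only [Set.mem_compl_iff, Set.mem_iUnion, Set.mem_singleton_iff, exists_prop]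
    constructor
    · intro hw
      obtain ⟨j, hj⟩ := hex w
      exact ⟨j, fun hji => hw (hji ▸ hj), hj⟩
    · rintro ⟨j, hji, hj⟩ hw
      exact hji (T.sheet_injective _ (hre w w.2) _ _ (Eq.trans hj (Eq.symm hw)))
  have hclopen : IsClopen (C i) := ⟨hclosed i, by
    rw [← isClosed_compl_iff, hcompl]
    exact (Set.toFinite _).isClosed_biUnion fun j _ => hclosed j⟩
  have huniv := hclopen.eq_univ ⟨⟨p, hp⟩, hi⟩
  have hqi : (⟨q, hq⟩ : S) ∈ C i := huniv ▸ Set.mem_univ _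
  refine Prod.ext hpq ?_
  have h1 : T.sheet i (Complex.log p.1) = p.2 := hi
  have h2 : T.sheet i (Complex.log q.1) = q.2 := hqi
  rw [← h1, ← h2, hpq]

end SheetSystem

/-- Mutually inverse maps between the parts of `X` and `Y` outside the ball of radius `R`,
which are `L`-Lipschitz and change norms by a factor at most `L`. -/
structure BiLipOutsideBall {E F : Type*} [NormedAddCommGroup E] [NormedAddCommGroup F]
    (X : Set E) (Y : Set F) (φ : E → F) (ψ : F → E) (L R : ℝ) : Prop where
  one_le : 1 ≤ L
  mapsTo : ∀ p ∈ X, R ≤ ‖p‖ → φ p ∈ Y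
  inv_mapsTo : ∀ q ∈ Y, R ≤ ‖q‖ → ψ q ∈ X
  left_inv : ∀ p ∈ X, R ≤ ‖p‖ → ψ (φ p) = p
  norm_le : ∀ p ∈ X, R ≤ ‖p‖ → ‖φ p‖ ≤ L * ‖p‖
  le_norm : ∀ p ∈ X, R ≤ ‖p‖ → ‖p‖ ≤ L * ‖φ p‖
  inv_le_norm : ∀ q ∈ Y, R ≤ ‖q‖ → ‖q‖ ≤ L * ‖ψ q‖
  dist_le : ∀ p ∈ X, ∀ p' ∈ X, R ≤ ‖p‖ → R ≤ ‖p'‖ → ‖φ p - φ p'‖ ≤ L * ‖p - p'‖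
  inv_dist_le : ∀ q ∈ Y, ∀ q' ∈ Y, R ≤ ‖q‖ → R ≤ ‖q'‖ → ‖ψ q - ψ q'‖ ≤ L * ‖q - q'‖

/-- A map satisfying a Lipschitz bound on `S` grows at most linearly outside a large ball. -/
theorem norm_le_two_mul_of_lipschitz {E F : Type*} [NormedAddCommGroup E]
    [NormedAddCommGroup F] {S : Set E} {φ : E → F} {L : ℝ} (hL : 1 ≤ L)
    (h : ∀ p ∈ S, ∀ p' ∈ S, ‖φ p - φ p'‖ ≤ L * ‖p - p'‖) :
    ∃ R : ℝ, ∀ p ∈ S, R ≤ ‖p‖ → ‖φ p‖ ≤ 2 * L * ‖p‖ := by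
  obtain rfl | ⟨p₀, hp₀⟩ := S.eq_empty_or_nonempty
  · exact ⟨0, by simp⟩
  refine ⟨‖p₀‖ + ‖φ p₀‖, fun p hp hR => ?_⟩
  have h1 := h p hp p₀ hp₀
  have h2 : ‖φ p‖ ≤ ‖φ p - φ p₀‖ + ‖φ p₀‖ := by simpa using norm_add_le (φ p - φ p₀) (φ p₀)
  have h3 := norm_sub_le p p₀
  nlinarith [norm_nonneg (φ p₀), norm_nonneg p₀, norm_nonneg p]

/-- A map satisfying a lower Lipschitz bound on `S` grows at least linearly outside a large
ball. -/
theorem norm_le_two_mul_of_antilipschitz {E F : Type*} [NormedAddCommGroup E]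
    [NormedAddCommGroup F] {S : Set E} {φ : E → F} {L : ℝ} (hL : 1 ≤ L)
    (h : ∀ p ∈ S, ∀ p' ∈ S, ‖p - p'‖ ≤ L * ‖φ p - φ p'‖) :
    ∃ R : ℝ, ∀ p ∈ S, R ≤ ‖p‖ → ‖p‖ ≤ 2 * L * ‖φ p‖ := by
  obtain rfl | ⟨p₀, hp₀⟩ := S.eq_empty_or_nonempty
  · exact ⟨0, by simp⟩
  refine ⟨2 * ‖p₀‖ + 2 * L * ‖φ p₀‖, fun p hp hR => ?_⟩
  have h1 := h p hp p₀ hp₀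
  have h2 : ‖p‖ ≤ ‖p - p₀‖ + ‖p₀‖ := by simpa using norm_add_le (p - p₀) p₀
  have h3 := norm_sub_le (φ p) (φ p₀)
  nlinarith [norm_nonneg (φ p₀), norm_nonneg p₀, norm_nonneg p]

theorem OuterBiLipAtInfty.exists_biLipOutsideBall {E F : Type*} [NormedAddCommGroup E]
    [NormedAddCommGroup F] {X : Set E} {Y : Set F} (h : OuterBiLipAtInfty X Y) :
    ∃ φ ψ L R, BiLipOutsideBall X Y φ ψ L R := by
  obtain ⟨K, K', φ, hK, hK', hφ, ⟨C, hC, hCle⟩, ⟨c, hc, hcle⟩⟩ := h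
  set ψ := Function.invFunOn φ (X \ K) with hψ
  have hinv : Set.InvOn ψ φ (X \ K) (Y \ K') := hφ.invOn_invFunOn
  have hψm : Set.MapsTo ψ (Y \ K') (X \ K) := hφ.surjOn.mapsTo_invFunOn
  set L := max 1 (max C c) with hLdef
  have hL1 : 1 ≤ L := le_max_left _ _
  have hCL : C ≤ L := (le_max_left _ _).trans (le_max_right _ _)
  have hcL : c ≤ L := (le_max_right _ _).trans (le_max_right _ _)
  simp only [dist_eq_norm] at hCle hcle
  have lip : ∀ p ∈ X \ K, ∀ p' ∈ X \ K, ‖φ p - φ p'‖ ≤ L * ‖p - p'‖ := fun p hp p' hp' =>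
    (hCle p hp p' hp').trans (by gcongr)
  have anti : ∀ p ∈ X \ K, ∀ p' ∈ X \ K, ‖p - p'‖ ≤ L * ‖φ p - φ p'‖ := fun p hp p' hp' =>
    (hcle p hp p' hp').trans (by gcongr)
  have lipψ : ∀ q ∈ Y \ K', ∀ q' ∈ Y \ K', ‖ψ q - ψ q'‖ ≤ L * ‖q - q'‖ := fun q hq q' hq' => by
    have := anti _ (hψm hq) _ (hψm hq')
    rwa [hinv.2 hq, hinv.2 hq'] at this
  have antiψ : ∀ q ∈ Y \ K', ∀ q' ∈ Y \ K', ‖q - q'‖ ≤ L * ‖ψ q - ψ q'‖ := fun q hq q' hq' => by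
    have := lip _ (hψm hq) _ (hψm hq')
    rwa [hinv.2 hq, hinv.2 hq'] at this
  obtain ⟨R₁, hR₁⟩ := hK.isBounded.exists_norm_le
  obtain ⟨R₂, hR₂⟩ := hK'.isBounded.exists_norm_le
  obtain ⟨R₃, hR₃⟩ := norm_le_two_mul_of_lipschitz hL1 lip
  obtain ⟨R₄, hR₄⟩ := norm_le_two_mul_of_antilipschitz hL1 anti
  obtain ⟨R₅, hR₅⟩ := norm_le_two_mul_of_antilipschitz hL1 antiψ
  obtain ⟨R, hR⟩ : ∃ R, R₁ + 1 ≤ R ∧ R₂ + 1 ≤ R ∧ R₃ ≤ R ∧ R₄ ≤ R ∧ R₅ ≤ R :=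
    ⟨max (R₁ + 1) (max (R₂ + 1) (max R₃ (max R₄ R₅))), by simp⟩
  have hX : ∀ p ∈ X, R ≤ ‖p‖ → p ∈ X \ K := fun p hp hpR =>
    ⟨hp, fun hpK => by have := hR₁ p hpK; linarith⟩
  have hY : ∀ q ∈ Y, R ≤ ‖q‖ → q ∈ Y \ K' := fun q hq hqR =>
    ⟨hq, fun hqK => by have := hR₂ q hqK; linarith⟩
  have hLL : L ≤ 2 * L := by linarith
  exact ⟨φ, ψ, 2 * L, R, {
    one_le := by linarith
    mapsTo := fun p hp hpR => (hφ.mapsTo (hX p hp hpR)).1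
    inv_mapsTo := fun q hq hqR => (hψm (hY q hq hqR)).1
    left_inv := fun p hp hpR => hinv.1 (hX p hp hpR)
    norm_le := fun p hp hpR => hR₃ p (hX p hp hpR) (by linarith)
    le_norm := fun p hp hpR => hR₄ p (hX p hp hpR) (by linarith)
    inv_le_norm := fun q hq hqR => hR₅ q (hY q hq hqR) (by linarith)
    dist_le := fun p hp p' hp' hpR hpR' =>
      (lip p (hX p hp hpR) p' (hX p' hp' hpR')).trans (by gcongr)
    inv_dist_le := fun q hq q' hq' hqR hqR' =>
      (lipψ q (hY q hq hqR) q' (hY q' hq' hqR')).trans (by gcongr) }⟩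

theorem OuterBiLipAtInfty.symm {E F : Type*} [NormedAddCommGroup E]
    [NormedAddCommGroup F] {X : Set E} {Y : Set F} (h : OuterBiLipAtInfty X Y) :
    OuterBiLipAtInfty Y X := by
  obtain ⟨K, K', φ, hK, hK', hφ, ⟨C, hC, hCle⟩, ⟨c, hc, hcle⟩⟩ := h
  have hinv := hφ.invOn_invFunOn
  have hψm := hφ.surjOn.mapsTo_invFunOn
  refine ⟨K', K, Function.invFunOn φ (X \ K), hK', hK, hinv.symm.bijOn hψm hφ.mapsTo,
    ⟨c, hc, fun a ha b hb => ?_⟩, ⟨C, hC, fun a ha b hb => ?_⟩⟩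
  · have := hcle _ (hψm ha) _ (hψm hb)
    rwa [hinv.2 ha, hinv.2 hb] at this
  · have := hCle _ (hψm ha) _ (hψm hb)
    rwa [hinv.2 ha, hinv.2 hb] at this

theorem OuterBiLipAtInfty.image_right {E F G : Type*} [NormedAddCommGroup E]
    [NormedAddCommGroup F] [NormedSpace ℂ F] [NormedAddCommGroup G] [NormedSpace ℂ G]
    {X : Set E} {Y : Set F} (h : OuterBiLipAtInfty X Y) (e : F ≃L[ℂ] G) :
    OuterBiLipAtInfty X (e '' Y) := by
  obtain ⟨K, K', φ, hK, hK', hφ, ⟨C, hC, hCle⟩, ⟨c, hc, hcle⟩⟩ := h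
  have he : ∀ a b, dist (e a) (e b) ≤ (‖(e : F →L[ℂ] G)‖ + 1) * dist a b := fun a b => by
    rw [dist_eq_norm, dist_eq_norm, ← map_sub]
    refine ((e : F →L[ℂ] G).le_opNorm (a - b)).trans ?_
    gcongr; linarith
  have he' : ∀ a b, dist a b ≤ (‖(e.symm : G →L[ℂ] F)‖ + 1) * dist (e a) (e b) := fun a b => by
    rw [dist_eq_norm, dist_eq_norm, ← map_sub]
    have := (e.symm : G →L[ℂ] F).le_opNorm (e (a - b))
    simp only [ContinuousLinearEquiv.coe_coe, ContinuousLinearEquiv.symm_apply_apply] at this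
    refine this.trans ?_
    gcongr; linarith
  refine ⟨K, e '' K', e ∘ φ, hK, hK'.image e.continuous, ?_,
    ⟨(‖(e : F →L[ℂ] G)‖ + 1) * C, by positivity, fun a ha b hb => ?_⟩,
    ⟨c * (‖(e.symm : G →L[ℂ] F)‖ + 1), by positivity, fun a ha b hb => ?_⟩⟩
  · rw [← Set.image_sdiff e.injective]
    exact (e.injective.injOn.bijOn_image).comp hφ
  · rw [mul_assoc]
    refine (he _ _).trans ?_
    gcongr
    exact hCle a ha b hb
  · rw [mul_assoc]
    refine (hcle a ha b hb).trans ?_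
    gcongr
    exact he' _ _

theorem Complex.exists_exp_eq_near_log {x b : ℂ} (hb : b ≠ 0) {τ : ℝ} (hτ : τ ≤ 1 / 2)
    (h : ‖x - b‖ ≤ τ * ‖b‖) :
    ∃ z : ℂ, Complex.exp z = x ∧ ‖z - Complex.log b‖ ≤ 3 / 2 * τ := by
  have hw : ‖(x - b) / b‖ ≤ τ := by
    rw [norm_div, div_le_iff₀ (norm_pos_iff.2 hb)]; exact h
  have hne : 1 + (x - b) / b ≠ 0 := fun h0 => by
    have : (x - b) / b = -1 := by linear_combination h0
    rw [this] at hw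
    norm_num at hw
    linarith
  refine ⟨Complex.log b + Complex.log (1 + (x - b) / b), ?_, ?_⟩
  · rw [Complex.exp_add, Complex.exp_log hb, Complex.exp_log hne]
    field_simp
    ring
  · rw [add_sub_cancel_left]
    exact (Complex.norm_log_one_add_half_le_self (hw.trans hτ)).trans (by gcongr)

namespace SheetSystem

variable {X Y : Set (ℂ × ℂ)} {d e : ℕ}

/-- The point of the `i`-th sheet over `exp z`. -/
noncomputable def point (T : SheetSystem X d) (i : Fin d) (z : ℂ) : ℂ × ℂ :=
  (Complex.exp z, T.sheet i z)

theorem point_mem (T : SheetSystem X d) (i : Fin d) {z : ℂ} (hz : T.radius < z.re) :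
    T.point i z ∈ X :=
  (T.mem_iff z hz _).2 ⟨i, rfl⟩

theorem continuousOn_point (T : SheetSystem X d) (i : Fin d) :
    ContinuousOn (T.point i) {z | T.radius < z.re} :=
  Complex.continuous_exp.continuousOn.prodMk (T.continuousOn_sheet i)

theorem exp_re_le_norm_point (T : SheetSystem X d) (i : Fin d) (z : ℂ) :
    Real.exp z.re ≤ ‖T.point i z‖ := by
  rw [← Complex.norm_exp]
  exact norm_fst_le (T.point i z)

/-- Along a set of sheet points of `X` whose logarithmic parameters are close to each other and
which has a common slope, the points stay close to each other. -/
theorem norm_point_sub_le (T : SheetSystem X d) (i : Fin d) {z w a : ℂ} {B η τ D : ℝ}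
    (haB : ‖a‖ ≤ B) (hη : 0 ≤ η) (hτ : τ ≤ 1 / 6) (hzw : ‖z - w‖ ≤ 3 * τ)
    (hD : ‖Complex.exp w‖ ≤ D)
    (hz : ‖T.sheet i z - a * Complex.exp z‖ ≤ η * ‖Complex.exp z‖)
    (hw : ‖T.sheet i w - a * Complex.exp w‖ ≤ η * ‖Complex.exp w‖) :
    ‖T.point i z - T.point i w‖ ≤ (1 + B) * (6 * τ * D) + 3 * η * D := by
  have hτ0 : 0 ≤ τ := by linarith [norm_nonneg (z - w)]
  have hD0 : 0 ≤ D := (norm_nonneg _).trans hD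
  have hB0 : 0 ≤ B := (norm_nonneg _).trans haB
  have hx : ‖Complex.exp z - Complex.exp w‖ ≤ 6 * τ * D := by
    have h1 : Complex.exp z - Complex.exp w = Complex.exp w * (Complex.exp (z - w) - 1) := by
      rw [mul_sub, ← Complex.exp_add]; simp
    rw [h1, norm_mul]
    have h2 := Complex.norm_exp_sub_one_le (x := z - w) (by linarith)
    calc _ ≤ D * (6 * τ) := by gcongr; linarith
      _ = _ := by ring
  have hz2 : ‖Complex.exp z‖ ≤ 2 * D := by
    have := norm_add_le (Complex.exp z - Complex.exp w) (Complex.exp w)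
    rw [sub_add_cancel] at this
    nlinarith
  have hy : ‖T.sheet i z - T.sheet i w‖ ≤ B * (6 * τ * D) + 3 * η * D := by
    have h1 : T.sheet i z - T.sheet i w = a * (Complex.exp z - Complex.exp w) +
        ((T.sheet i z - a * Complex.exp z) - (T.sheet i w - a * Complex.exp w)) := by ring
    rw [h1]
    refine (norm_add_le _ _).trans (add_le_add ?_ ((norm_sub_le _ _).trans ?_))
    · rw [norm_mul]; gcongr
    · have := mul_le_mul_of_nonneg_left hz2 hη
      have := mul_le_mul_of_nonneg_left hD hη
      linarith
  have h1 : 0 ≤ B * (6 * τ * D) + 3 * η * D := by positivity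
  have h2 : 0 ≤ 6 * τ * D := by positivity
  rw [Prod.norm_def]
  refine max_le ?_ ?_
  · refine hx.trans ?_
    linarith [h1]
  · refine hy.trans ?_
    linarith [h2]

/-- The number of sheets does not decrease under a map which is bi-Lipschitz near infinity. -/
theorem le_of_biLipOutsideBall (T : SheetSystem X d) (U : SheetSystem Y e)
    {φ ψ : ℂ × ℂ → ℂ × ℂ} {L R : ℝ} (h : BiLipOutsideBall X Y φ ψ L R) : d ≤ e := by
  obtain rfl | hd := Nat.eq_zero_or_pos d
  · exact Nat.zero_le _
  have : Nonempty (Fin d) := ⟨⟨0, hd⟩⟩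
  have hL := h.one_le
  obtain ⟨M, hM, N₁, hN₁, hN₁'⟩ : ∃ M : ℝ, 1 ≤ M ∧ ∃ N : ℝ,
      (∀ q ∈ Y, N ≤ ‖q‖ → ‖q‖ ≤ M * ‖q.1‖) ∧ ∀ p ∈ X, N ≤ ‖p‖ → ‖p‖ ≤ M * ‖p.1‖ := by
    obtain ⟨M, hM, N, hN⟩ := U.asymptotic.norm_le
    obtain ⟨M', -, N', hN'⟩ := T.asymptotic.norm_le
    refine ⟨max M M', hM.trans (le_max_left _ _), max N N', fun q hq hqN => ?_,
      fun p hp hpN => ?_⟩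
    · exact (hN q hq ((le_max_left _ _).trans hqN)).trans (by gcongr; exact le_max_left _ _)
    · exact (hN' p hp ((le_max_right _ _).trans hpN)).trans (by gcongr; exact le_max_right _ _)
  obtain ⟨σ, hσ, hsep⟩ := T.slopes.exists_separation
  obtain ⟨B, hB0, hB⟩ := U.slopes.exists_norm_le
  set η' : ℝ := 1 / (32 * L ^ 2 * M) with hη'
  have hη0' : 0 < η' := by positivity
  set τ : ℝ := 1 / (96 * (1 + B) * L ^ 2 * M) with hτ
  have hτ0 : 0 < τ := by positivity
  have hτ1 : τ ≤ 1 / 6 := by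
    rw [hτ]
    gcongr
    have : 1 ≤ (1 + B) * L ^ 2 * M :=
      one_le_mul_of_one_le_of_one_le (one_le_mul_of_one_le_of_one_le (by linarith)
        (one_le_pow₀ hL)) hM
    linarith
  set η : ℝ := min (σ / 3) (τ / (2 * L ^ 2 * M)) with hη
  have hη0 : 0 < η := by positivity
  have hησ : η ≤ σ / 3 := min_le_left _ _
  have hητ : η * (2 * L ^ 2 * M) ≤ τ := by
    rw [← le_div_iff₀ (by positivity)]; exact min_le_right _ _
  obtain ⟨N₂, hN₂⟩ := T.asymptotic.exists_common_slope hη0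
  obtain ⟨N₃, hN₃⟩ := U.asymptotic.exists_common_slope hη0'
  obtain ⟨t, ht1, htR, htN₁, htN₂, htN₃, htT, htU⟩ : ∃ t : ℝ, 1 ≤ t ∧ R ≤ t ∧ N₁ ≤ t ∧ N₂ ≤ t ∧
      N₃ ≤ t ∧ Real.exp T.radius + 1 ≤ t ∧ Real.exp U.radius + 1 ≤ t :=
    ⟨max 1 (max R (max N₁ (max N₂ (max N₃ (max (Real.exp T.radius + 1)
      (Real.exp U.radius + 1)))))), by simp⟩
  have ht0 : 0 < t := by linarith
  -- the base point of the fibre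
  set r : ℝ := 2 * L ^ 2 * M * t with hr
  have hr0 : 0 < r := by positivity
  have hLM : 1 ≤ L * M := one_le_mul_of_one_le_of_one_le hL hM
  have hL2M : 1 ≤ L ^ 2 * M := one_le_mul_of_one_le_of_one_le (one_le_pow₀ hL) hM
  have htr : 2 * t ≤ r := by rw [hr]; nlinarith
  set z₀ : ℂ := ((Real.log r : ℝ) : ℂ) with hz₀
  have hexp₀ : Complex.exp z₀ = (r : ℂ) := by
    rw [hz₀, ← Complex.ofReal_exp, Real.exp_log hr0]
  have hz₀r : T.radius < z₀.re := by
    rw [hz₀, Complex.ofReal_re, Real.lt_log_iff_exp_lt hr0]; linarith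
  set p : Fin d → ℂ × ℂ := fun i => T.point i z₀ with hp
  have hpX : ∀ i, p i ∈ X := fun i => T.point_mem i hz₀r
  have hp1 : ∀ i, (p i).1 = (r : ℂ) := fun i => hexp₀
  have hpr : ∀ i, r ≤ ‖p i‖ := fun i => by
    have := norm_fst_le (p i)
    rwa [hp1, Complex.norm_real, Real.norm_of_nonneg hr0.le] at this
  have hpR : ∀ i, R ≤ ‖p i‖ := fun i => by linarith [hpr i]
  have hslope : ∀ i, ∃ a ∈ T.slopes, ‖(p i).2 - a * (p i).1‖ ≤ η * ‖(p i).1‖ := fun i => by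
    obtain ⟨a, ha, haS⟩ := hN₂ {p i} (by simpa using hpX i) isPreconnected_singleton
      (Set.singleton_nonempty _) (by simpa using by linarith [hpr i])
    exact ⟨a, ha, haS _ rfl⟩
  choose a haA ha using hslope
  have hpdist : ∀ i j, a i = a j → ‖p i - p j‖ ≤ 2 * η * r := fun i j hij => by
    have h1 := ha i
    have h2 := ha j
    rw [hp1, Complex.norm_real, Real.norm_of_nonneg hr0.le] at h1 h2
    rw [hij] at h1
    rw [Prod.norm_def]
    refine max_le ?_ ?_
    · simp only [Prod.fst_sub, hp1, sub_self, norm_zero]; positivity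
    · have := norm_sub_le ((p i).2 - a j * r) ((p j).2 - a j * r)
      rw [sub_sub_sub_cancel_right] at this
      exact this.trans (by linarith)
  -- the images of the points of the fibre
  set q : Fin d → ℂ × ℂ := fun i => φ (p i) with hq
  have hqY : ∀ i, q i ∈ Y := fun i => h.mapsTo _ (hpX i) (hpR i)
  have hψq : ∀ i, ψ (q i) = p i := fun i => h.left_inv _ (hpX i) (hpR i)
  set ρ : ℝ := 2 * L * t with hρ
  have hρ0 : 0 < ρ := by positivity
  have htρ : t ≤ ρ := by nlinarith
  have hqnorm : ∀ i, M * ρ ≤ ‖q i‖ := fun i => by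
    have h1 := h.le_norm _ (hpX i) (hpR i)
    have h2 := hpr i
    have h3 : L * (M * ρ) ≤ L * ‖q i‖ := by
      calc L * (M * ρ) = r := by rw [hr, hρ]; ring
        _ ≤ _ := h2.trans h1
    exact le_of_mul_le_mul_left h3 (by linarith)
  have hqfst : ∀ i, ρ ≤ ‖(q i).1‖ := fun i => by
    have h1 := hqnorm i
    have h2 := hN₁ _ (hqY i) (by nlinarith)
    exact le_of_mul_le_mul_left (h1.trans h2) (by linarith)
  have hqfst' : ∀ i, ‖(q i).1‖ ≤ L * M * r := fun i => by
    have h1 := hN₁' _ (hpX i) (by linarith [hpr i])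
    rw [hp1, Complex.norm_real, Real.norm_of_nonneg hr0.le] at h1
    have h2 := h.norm_le _ (hpX i) (hpR i)
    calc ‖(q i).1‖ ≤ ‖q i‖ := norm_fst_le _
      _ ≤ L * ‖p i‖ := h2
      _ ≤ L * (M * r) := by gcongr
      _ = _ := by ring
  have hqdist : ∀ i j, a i = a j → ‖(q i).1 - (q j).1‖ ≤ τ * ‖(q j).1‖ := fun i j hij => by
    calc ‖(q i).1 - (q j).1‖ ≤ ‖q i - q j‖ := norm_fst_le (q i - q j)
      _ ≤ L * ‖p i - p j‖ := h.dist_le _ (hpX i) _ (hpX j) (hpR i) (hpR j)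
      _ ≤ L * (2 * η * r) := by gcongr; exact hpdist i j hij
      _ = η * (2 * L ^ 2 * M) * ρ := by rw [hr, hρ]; ring
      _ ≤ τ * ‖(q j).1‖ := by gcongr; exact hqfst j
  -- logarithmic parameters of the images
  have hrep : ∀ i, a (Function.invFun a (a i)) = a i := fun i =>
    Function.invFun_eq ⟨i, rfl⟩
  have hz : ∀ i, ∃ z, Complex.exp z = (q i).1 ∧
      ‖z - Complex.log (q (Function.invFun a (a i))).1‖ ≤ 3 / 2 * τ := fun i =>
    Complex.exists_exp_eq_near_log (norm_pos_iff.1 (hρ0.trans_le (hqfst _))) (by linarith)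
      (hqdist _ _ (hrep i).symm)
  choose z hzexp hzlog using hz
  have hzdist : ∀ i j, a i = a j → ‖z i - z j‖ ≤ 3 * τ := fun i j hij => by
    have h1 := hzlog i
    have h2 := hzlog j
    rw [hij] at h1
    have := norm_sub_le (z i - Complex.log (q (Function.invFun a (a j))).1)
      (z j - Complex.log (q (Function.invFun a (a j))).1)
    rw [sub_sub_sub_cancel_right] at this
    linarith
  set H : Set ℂ := {w | Real.log ρ ≤ w.re} with hH
  have hHconv : Convex ℝ H := convex_halfSpace_re_ge _
  have hzH : ∀ i, z i ∈ H := fun i => by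
    have h1 := hqfst i
    rw [← hzexp, Complex.norm_exp] at h1
    exact (Real.log_le_iff_le_exp hρ0).2 h1
  have hHU : ∀ w ∈ H, U.radius < w.re := fun w hw => by
    refine lt_of_lt_of_le ?_ (show Real.log ρ ≤ w.re from hw)
    rw [Real.lt_log_iff_exp_lt hρ0]; linarith
  have hm : ∀ i, ∃ k, U.sheet k (z i) = (q i).2 := fun i => by
    rw [← U.mem_iff _ (hHU _ (hzH i)), hzexp]; exact hqY i
  choose m hm using hm
  have hmq : ∀ i, U.point (m i) (z i) = q i := fun i => Prod.ext (hzexp i) (hm i)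
  have hHnorm : ∀ k, ∀ w ∈ H, ρ ≤ ‖U.point k w‖ := fun k w hw =>
    ((Real.log_le_iff_le_exp hρ0).1 hw).trans (U.exp_re_le_norm_point k w)
  have hHcont : ∀ k, ContinuousOn (U.point k) H := fun k =>
    (U.continuousOn_point k).mono hHU
  have hHY : ∀ k, ∀ w ∈ H, U.point k w ∈ Y := fun k w hw => U.point_mem k (hHU w hw)
  have hψcont : ContinuousOn ψ {y | y ∈ Y ∧ R ≤ ‖y‖} := by
    refine (LipschitzOnWith.of_dist_le_mul (K := ⟨L, by linarith⟩) fun y hy y' hy' => ?_).continuousOn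
    rw [dist_eq_norm, dist_eq_norm]
    exact h.inv_dist_le y hy.1 y' hy'.1 hy.2 hy'.2
  have hHmaps : ∀ k, Set.MapsTo (U.point k) H {y | y ∈ Y ∧ R ≤ ‖y‖} := fun k w hw =>
    ⟨hHY k w hw, by linarith [hHnorm k w hw]⟩
  have hHψ : ∀ k, ContinuousOn (fun w => ψ (U.point k w)) H := fun k =>
    hψcont.comp (hHcont k) (hHmaps k)
  have hHX : ∀ k, ∀ w ∈ H, ψ (U.point k w) ∈ X := fun k w hw =>
    h.inv_mapsTo _ (hHmaps k hw).1 (hHmaps k hw).2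
  have hHψnorm : ∀ k, ∀ w ∈ H, t ≤ ‖ψ (U.point k w)‖ := fun k w hw => by
    have h1 := h.inv_le_norm _ (hHmaps k hw).1 (hHmaps k hw).2
    have h2 := hHnorm k w hw
    have h3 : L * (2 * t) ≤ L * ‖ψ (U.point k w)‖ := by rw [hρ] at h2; linarith
    have := le_of_mul_le_mul_left h3 (by linarith)
    linarith
  have hinj : Function.Injective m := by
    intro i j hij
    have hmqj : U.point (m i) (z j) = q j := hij ▸ hmq j
    -- the two points of the fibre have the same slope
    obtain ⟨c, hcA, hc⟩ := hN₂ ((fun w => ψ (U.point (m i) w)) '' H)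
      (by rintro _ ⟨w, hw, rfl⟩; exact hHX _ w hw)
      (hHconv.isPreconnected.image _ (hHψ _)) ⟨_, z i, hzH i, rfl⟩
      (by rintro _ ⟨w, hw, rfl⟩; exact htN₂.trans (hHψnorm _ w hw))
    have hslope_eq : ∀ l, U.point (m i) (z l) = q l → a l = c := fun l hl => by
      have h1 := hc _ ⟨z l, hzH l, rfl⟩
      have h2 := ha l
      simp only [hl, hψq] at h1
      rw [hp1, Complex.norm_real, Real.norm_of_nonneg hr0.le] at h1 h2
      refine hsep _ (haA l) _ hcA ?_
      have h3 : ‖a l - c‖ * r ≤ 2 * η * r := by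
        calc ‖a l - c‖ * r = ‖((p l).2 - c * r) - ((p l).2 - a l * r)‖ := by
              rw [show ((p l).2 - c * r) - ((p l).2 - a l * r) = (a l - c) * r by ring, norm_mul,
                Complex.norm_real, Real.norm_of_nonneg hr0.le]
          _ ≤ _ := (norm_sub_le _ _).trans (by linarith)
      have := le_of_mul_le_mul_right h3 hr0
      linarith
    have haij : a i = a j := (hslope_eq i (hmq i)).trans (hslope_eq j hmqj).symm
    -- the segment between the two parameters is short, so its image stays near `p i`
    obtain ⟨b, hbA, hb⟩ := hN₃ (U.point (m i) '' H)
      (by rintro _ ⟨w, hw, rfl⟩; exact hHY _ w hw)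
      (hHconv.isPreconnected.image _ (hHcont _)) ⟨_, z i, hzH i, rfl⟩
      (by rintro _ ⟨w, hw, rfl⟩; linarith [hHnorm (m i) w hw])
    have hsegH : segment ℝ (z i) (z j) ⊆ H := hHconv.segment_subset (hzH i) (hzH j)
    have hnear : ∀ w ∈ segment ℝ (z i) (z j), ‖ψ (U.point (m i) w) - p i‖ ≤ r / 2 :=
      fun w hw => by
      have hwz : ‖w - z i‖ ≤ 3 * τ :=
        (norm_sub_le_of_mem_segment hw).trans (hzdist j i haij.symm)
      have h1 := U.norm_point_sub_le (m i) (hB b hbA) hη0'.le hτ1 hwz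
        ((congrArg norm (hzexp i)).trans_le (hqfst' i))
        (hb _ ⟨w, hsegH hw, rfl⟩) (hb _ ⟨z i, hzH i, rfl⟩)
      have h2 := h.inv_dist_le _ (hHmaps (m i) (hsegH hw)).1 _ (hHmaps (m i) (hzH i)).1
        (hHmaps (m i) (hsegH hw)).2 (hHmaps (m i) (hzH i)).2
      rw [hmq, hψq, ← hmq i] at h2
      calc ‖ψ (U.point (m i) w) - p i‖
          ≤ L * ((1 + B) * (6 * τ * (L * M * r)) + 3 * η' * (L * M * r)) := by
            refine h2.trans ?_
            gcongr
        _ = r / 16 + 3 * r / 32 := by rw [hτ, hη']; field_simp; ring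
        _ ≤ r / 2 := by linarith
    have hre : ∀ w ∈ segment ℝ (z i) (z j), r / 2 ≤ (ψ (U.point (m i) w)).1.re :=
      fun w hw => by
      have h1 := (norm_fst_le (ψ (U.point (m i) w) - p i)).trans (hnear w hw)
      have h2 := (Complex.abs_re_le_norm _).trans h1
      rw [Prod.fst_sub, hp1, Complex.sub_re, Complex.ofReal_re, abs_le] at h2
      linarith [h2.1]
    have hpp : p i = p j := by
      refine T.eq_of_isPreconnected
        (S := (fun w => ψ (U.point (m i) w)) '' segment ℝ (z i) (z j)) ?_
        ((convex_segment _ _).isPreconnected.image _ ((hHψ _).mono hsegH)) ?_ ?_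
        ⟨z i, left_mem_segment _ _ _, ?_⟩ ⟨z j, right_mem_segment _ _ _, ?_⟩ ?_
      · rintro _ ⟨w, hw, rfl⟩; exact hHX _ w (hsegH hw)
      · rintro _ ⟨w, hw, rfl⟩
        exact Or.inl ((half_pos hr0).trans_le (hre w hw))
      · rintro _ ⟨w, hw, rfl⟩
        have h1 := (hre w hw).trans ((le_abs_self _).trans (Complex.abs_re_le_norm _))
        rw [Real.lt_log_iff_exp_lt (by linarith)]
        linarith
      · simp only [hmq, hψq]
      · simp only [hmqj, hψq]
      · rw [hp1, hp1]
    exact T.sheet_injective z₀ hz₀r i j (congrArg Prod.snd hpp)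
  simpa using Fintype.card_le_of_injective m hinj

end SheetSystem

/-- A homeomorphism of the form `p ↦ (F p, p.1)` near a zero of `F` restricts to a homeomorphism
from the zero set of `F` to the first factor. -/
theorem isLocalHomeomorphOn_fst_zeroSet {F : ℂ × ℂ → ℂ} {s : Set {p // F p = 0}}
    (h : ∀ p ∈ s, ∃ e : OpenPartialHomeomorph (ℂ × ℂ) (ℂ × ℂ), p.1 ∈ e.source ∧
      ∀ q, e q = (F q, q.1)) :
    IsLocalHomeomorphOn (fun p : {p // F p = 0} => p.1.1) s := by
  classical
  refine IsLocalHomeomorphOn.mk _ _ fun p hp => ?_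
  obtain ⟨e, hpe, he⟩ := h p hp
  have hinv : ∀ x, ((0 : ℂ), x) ∈ e.target →
      F (e.symm (0, x)) = 0 ∧ (e.symm (0, x)).1 = x := fun x hx => by
    have := e.right_inv hx
    rw [he] at this
    exact ⟨congrArg Prod.fst this, congrArg Prod.snd this⟩
  have hmap : ∀ q : {p // F p = 0}, e q.1 = (0, q.1.1) := fun q => by rw [he, q.2]
  have hcont : Continuous fun x : ℂ => ((0 : ℂ), x) := by fun_prop
  refine ⟨{
    toFun := fun q => q.1.1
    invFun := fun x => if hx : ((0 : ℂ), x) ∈ e.target then ⟨e.symm (0, x), (hinv x hx).1⟩ else p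
    source := Subtype.val ⁻¹' e.source
    target := {x | ((0 : ℂ), x) ∈ e.target}
    map_source' := fun q hq => by
      have := e.map_source hq
      rwa [hmap] at this
    map_target' := fun x hx => by
      rw [Set.mem_ofPred_eq] at hx
      simp only [dif_pos hx]
      exact e.map_target hx
    left_inv' := fun q hq => by
      have h1 := e.map_source hq
      rw [hmap] at h1
      simp only [dif_pos h1]
      exact Subtype.ext (by simp only [← hmap]; exact e.left_inv hq)
    right_inv' := fun x hx => by
      rw [Set.mem_ofPred_eq] at hx
      simp only [dif_pos hx]
      exact (hinv x hx).2
    open_source := e.open_source.preimage continuous_subtype_val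
    open_target := e.open_target.preimage hcont
    continuousOn_toFun := (continuous_fst.comp continuous_subtype_val).continuousOn
    continuousOn_invFun := by
      refine (Topology.IsInducing.induced (Subtype.val : {p // F p = 0} → ℂ × ℂ)).continuousOn_iff.2 ?_
      refine (e.continuousOn_symm.comp hcont.continuousOn fun x hx => hx).congr fun x hx => ?_
      replace hx : ((0 : ℂ), x) ∈ e.target := hx
      simp only [Function.comp_apply, dif_pos hx] }, hpe, fun q _ => rfl⟩

/-- A plane curve asymptotic to finitely many non-vertical lines, which far away is a nonsingular
`d`-fold cover of the first axis, decomposes into sheets near infinity. -/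
theorem AsymptoticToLines.nonempty_sheetSystem {F : ℂ × ℂ → ℂ} (hF : ContDiff ℂ 1 F)
    {A : Finset ℂ} (hA : AsymptoticToLines {p | F p = 0} A) {d : ℕ} {R : ℝ}
    (hcard : ∀ x : ℂ, R < ‖x‖ → {y | F (x, y) = 0}.encard = d)
    (hder : ∀ x y : ℂ, R < ‖x‖ → F (x, y) = 0 → fderiv ℂ F (x, y) (0, 1) ≠ 0) :
    Nonempty (SheetSystem {p | F p = 0} d) := by
  set E := {p : ℂ × ℂ // F p = 0}
  set π : E → ℂ := fun p => p.1.1 with hπdef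
  have hπ : Continuous π := continuous_fst.comp continuous_subtype_val
  have hproper : IsProperMap π := by
    refine isProperMap_iff_isCompact_preimage.2 ⟨hπ, fun K hK => ?_⟩
    refine (Topology.IsInducing.induced (Subtype.val : {p // F p = 0} → ℂ × ℂ)).isCompact_iff.2 ?_
    obtain ⟨M, hM, N, hN⟩ := hA.norm_le
    obtain ⟨C, hC⟩ := hK.isBounded.exists_norm_le
    have himage : Subtype.val '' (π ⁻¹' K) = {p : ℂ × ℂ | F p = 0} ∩ Prod.fst ⁻¹' K := by
      ext p
      constructor
      · rintro ⟨q, hq, rfl⟩; exact ⟨q.2, hq⟩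
      · rintro ⟨h1, h2⟩; exact ⟨⟨p, h1⟩, h2, rfl⟩
    rw [himage]
    refine Metric.isCompact_of_isClosed_isBounded ((isClosed_singleton.preimage
      hF.continuous).inter (hK.isClosed.preimage continuous_fst)) ?_
    refine isBounded_iff_forall_norm_le.2 ⟨max N (M * C), fun p hp => ?_⟩
    by_cases hpN : N ≤ ‖p‖
    · refine le_max_of_le_right ((hN p hp.1 hpN).trans ?_)
      gcongr
      exact hC _ hp.2
    · exact le_max_of_le_left (not_le.1 hpN).le
  set s : Set ℂ := {x | R < ‖x‖} with hs
  have hfin : ∀ x ∈ s, {y | F (x, y) = 0}.Finite := fun x hx =>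
    Set.finite_of_encard_eq_coe (hcard x hx)
  have hcov : IsCoveringMapOn π s := by
    refine hproper.isClosedMap.isCoveringMapOn_of_isLocalHomeomorphOn (fun x hx => ?_)
      (isLocalHomeomorphOn_fst_zeroSet fun p hp => ?_)
    · refine Set.Finite.of_finite_image (f := fun p : E => p.1.2) ((hfin x hx).subset ?_) ?_
      · rintro _ ⟨p, rfl, rfl⟩
        exact p.2
      · intro p hp q hq hpq
        exact Subtype.ext (Prod.ext (Eq.trans hp (Eq.symm hq)) hpq)
    · have hstrict := hF.contDiffAt.hasStrictFDerivAt (x := p.1) one_ne_zero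
      have hne := hder p.1.1 p.1.2 hp p.2
      have hinv : (fderiv ℂ F p.1 ∘L ContinuousLinearMap.inr ℂ ℂ ℂ).IsInvertible := by
        refine ⟨ContinuousLinearEquiv.unitsEquivAut ℂ (Units.mk0 _ hne), ?_⟩
        ext
        simp
      exact ⟨(hstrict.implicitFunctionDataOfProdDomain hinv).toOpenPartialHomeomorph,
        ImplicitFunctionData.pt_mem_toOpenPartialHomeomorph_source _, fun q => rfl⟩
  have hcov' := hcov.isCoveringMap_restrictPreimage
  set H : Set ℂ := {z | R < z.re} with hH
  have hHopen : IsOpen H := isOpen_lt continuous_const Complex.continuous_re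
  have : LocallyPathConnectedSpace H := hHopen.locallyPathConnectedSpace
  have hHne : H.Nonempty := ⟨((R + 1 : ℝ) : ℂ), by simp [hH]⟩
  have : ContractibleSpace H := (convex_halfSpace_re_gt R).contractibleSpace hHne
  have hexp : ∀ z ∈ H, Complex.exp z ∈ s := fun z hz => by
    rw [hs, Set.mem_ofPred_eq, Complex.norm_exp]
    have := Real.add_one_le_exp z.re
    have : R < z.re := hz
    linarith
  let f : C(H, s) := ⟨fun z => ⟨Complex.exp z, hexp z z.2⟩, by fun_prop⟩
  obtain ⟨z₀, hz₀⟩ := hHne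
  have hlift := hcov'.existsUnique_continuousMap_lifts f
  have hcard' : ∀ x ∈ s, Nat.card {y | F (x, y) = 0} = d := fun x hx => by
    rw [Nat.card_coe_set_eq, Set.ncard, hcard x hx, ENat.toNat_natCast]
  have := (hfin _ (hexp z₀ hz₀)).to_subtype
  let b := (Finite.equivFinOfCardEq (hcard' _ (hexp z₀ hz₀))).symm
  choose G hG _ using fun i => hlift ⟨z₀, hz₀⟩
    ⟨⟨(Complex.exp z₀, (b i).1), (b i).2⟩, hexp z₀ hz₀⟩ rfl
  have hGfst : ∀ i (z : H), (G i z).1.1.1 = Complex.exp z := fun i z =>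
    congrArg Subtype.val (congrFun (hG i).2 z)
  have hGinj : ∀ (z : H) i j, (G i z).1.1.2 = (G j z).1.1.2 → i = j := fun z i j hij => by
    have hz : G i z = G j z := Subtype.ext (Subtype.ext (Prod.ext
      ((hGfst i z).trans (hGfst j z).symm) hij))
    have := (hlift z (G i z) (congrFun (hG i).2 z)).unique ⟨rfl, (hG i).2⟩ ⟨hz.symm, (hG j).2⟩
    have h0 := congrArg (fun g : C(H, π ⁻¹' s) => (g ⟨z₀, hz₀⟩).1.1.2) this
    simp only [(hG _).1] at h0
    exact b.injective (Subtype.ext h0)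
  classical
  let S : Fin d → ℂ → ℂ := fun i z => if hz : z ∈ H then (G i ⟨z, hz⟩).1.1.2 else 0
  have hS : ∀ i (z : H), S i z = (G i z).1.1.2 := fun i z => dif_pos z.2
  have hinj : ∀ z : H, ∀ i j, S i z = S j z → i = j := fun z i j hij => by
    rw [hS, hS] at hij
    exact hGinj z i j hij
  have hmem : ∀ i (z : H), F (Complex.exp z, S i z) = 0 := fun i z => by
    rw [hS, ← hGfst i z]
    exact (G i z).1.2
  refine ⟨⟨A, hA, R, S, fun i => ?_, fun z hz => hinj ⟨z, hz⟩, fun z hz y => ⟨fun hy => ?_, ?_⟩⟩⟩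
  · rw [continuousOn_iff_continuous_domRestrict]
    have : H.domRestrict (S i) = fun z => (G i z).1.1.2 := funext fun z => hS i z
    rw [← hH, this]
    exact continuous_snd.comp (continuous_subtype_val.comp
      (continuous_subtype_val.comp (G i).continuous))
  · have := (hfin _ (hexp z hz)).to_subtype
    have := Fintype.ofFinite {y | F (Complex.exp z, y) = 0}
    have hbij : Function.Bijective
        fun i => (⟨S i z, hmem i ⟨z, hz⟩⟩ : {y | F (Complex.exp z, y) = 0}) := by
      rw [Fintype.bijective_iff_injective_and_card]
      refine ⟨fun i j hij => hinj ⟨z, hz⟩ i j (congrArg Subtype.val hij), ?_⟩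
      rw [← Nat.card_eq_fintype_card, ← Nat.card_eq_fintype_card, hcard' _ (hexp z hz),
        Nat.card_fin]
    obtain ⟨i, hi⟩ := hbij.2 ⟨y, hy⟩
    exact ⟨i, congrArg Subtype.val hi⟩
  · rintro ⟨i, rfl⟩
    exact hmem i ⟨z, hz⟩

theorem Polynomial.Monic.squarefree_map_fractionRing {R : Type*} [CommRing R] [IsDomain R]
    [IsIntegrallyClosed R] {P : Polynomial R} (hP : P.Monic) (hsq : Squarefree P) :
    Squarefree (P.map (algebraMap R (FractionRing R))) := by
  intro x hx
  have hinj := IsFractionRing.injective R (FractionRing R)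
  have hx0 : x ≠ 0 := by
    rintro rfl
    rw [zero_mul, zero_dvd_iff] at hx
    exact (hP.map _).ne_zero hx
  have hlead : IsUnit (Polynomial.C x.leadingCoeff) :=
    Polynomial.isUnit_C.2 (isUnit_iff_ne_zero.2 (Polynomial.leadingCoeff_ne_zero.2 hx0))
  obtain ⟨g, hg⟩ := IsIntegrallyClosed.eq_map_mul_C_of_dvd _ hP ((dvd_mul_right x x).trans hx)
  have hgm : g.Monic := by
    refine Polynomial.monic_of_injective hinj ?_
    have := congrArg Polynomial.leadingCoeff hg
    rw [Polynomial.leadingCoeff_mul, Polynomial.leadingCoeff_C] at this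
    exact mul_right_cancel₀ (Polynomial.leadingCoeff_ne_zero.2 hx0) (this.trans (one_mul _).symm)
  have hgx : g.map (algebraMap R (FractionRing R)) ∣ x := ⟨_, hg.symm⟩
  have hgg : g * g ∣ P := by
    rw [← Polynomial.map_dvd_map _ hinj (hgm.mul hgm), Polynomial.map_mul]
    exact (mul_dvd_mul hgx hgx).trans hx
  rw [← hg]
  exact ((hsq g hgg).map (Polynomial.mapRingHom (algebraMap R (FractionRing R)))).mul hlead

/-- A squarefree polynomial monic in the second variable specializes to separable polynomials
outside the zeros of a nonzero polynomial. -/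
theorem Polynomial.Monic.exists_separable_map_evalRingHom {P : Polynomial (Polynomial ℂ)}
    (hP : P.Monic) (hsq : Squarefree P) :
    ∃ w : Polynomial ℂ, w ≠ 0 ∧
      ∀ x, w.eval x ≠ 0 → (P.map (Polynomial.evalRingHom x)).Separable := by
  by_cases h0 : P.natDegree = 0
  · obtain rfl := hP.natDegree_eq_zero.1 h0
    exact ⟨1, one_ne_zero, fun x _ => by
      rw [Polynomial.map_one]; exact Polynomial.separable_one⟩
  set ι := algebraMap (Polynomial ℂ) (FractionRing (Polynomial ℂ)) with hι
  have hinj : Function.Injective ι := IsFractionRing.injective _ _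
  have hsep : (P.map ι).Separable :=
    PerfectField.separable_iff_squarefree.2 (hP.squarefree_map_fractionRing hsq)
  have hres := Polynomial.resultant_ne_zero _ _ hsep
  rw [Polynomial.derivative_map, Polynomial.natDegree_map_eq_of_injective hinj,
    Polynomial.natDegree_map_eq_of_injective hinj, Polynomial.resultant_map_map] at hres
  obtain ⟨u, v, -, -, huv⟩ := Polynomial.exists_mul_add_mul_eq_C_resultant
    P P.derivative le_rfl le_rfl (Or.inl h0)
  refine ⟨P.resultant P.derivative P.natDegree P.derivative.natDegree,
    fun h => hres (by rw [h, map_zero]), fun x hx => ?_⟩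
  have h1 := congrArg (Polynomial.map (Polynomial.evalRingHom x)) huv
  rw [Polynomial.map_add, Polynomial.map_mul, Polynomial.map_mul, Polynomial.map_C,
    Polynomial.coe_evalRingHom, ← Polynomial.derivative_map] at h1
  set c := Polynomial.eval x (P.resultant P.derivative P.natDegree P.derivative.natDegree)
  refine ⟨Polynomial.C c⁻¹ * u.map (Polynomial.evalRingHom x),
    Polynomial.C c⁻¹ * v.map (Polynomial.evalRingHom x), ?_⟩
  have h2 : Polynomial.C c⁻¹ * Polynomial.C c = 1 := by
    rw [← Polynomial.C_mul, inv_mul_cancel₀ hx, Polynomial.C_1]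
  rw [← h2, ← h1]
  ring

theorem MvPolynomial.IsHomogeneous.eval_smul_eq {σ R : Type*} [CommSemiring R]
    {φ : MvPolynomial σ R} {n : ℕ} (h : φ.IsHomogeneous n) (t : R) (v : σ → R) :
    eval (t • v) φ = t ^ n * eval v φ := by
  rw [eval_eq, eval_eq, Finset.mul_sum]
  refine Finset.sum_congr rfl fun s hs => ?_
  have hdeg : ∑ i ∈ s.support, s i = n := by
    have := h (mem_support_iff.1 hs)
    simpa [Finsupp.weight_apply, Finsupp.sum] using this
  simp only [Pi.smul_apply, smul_eq_mul, mul_pow, Finset.prod_mul_distrib,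
    Finset.prod_pow_eq_pow_sum, hdeg]
  ring

/-- The form of top degree of a nonconstant polynomial does not vanish at some point `(a, 1)`. -/
theorem MvPolynomial.IsHomogeneous.exists_eval_ne_zero {φ : MvPolynomial (Fin 2) ℂ} {n : ℕ}
    (h : φ.IsHomogeneous n) (h0 : φ ≠ 0) : ∃ a : ℂ, eval ![a, 1] φ ≠ 0 := by
  have hne : φ * X 1 ≠ 0 := mul_ne_zero h0 (X_ne_zero _)
  obtain ⟨v, hv⟩ : ∃ v, eval v (φ * X 1) ≠ 0 := by
    by_contra! hall
    exact hne (MvPolynomial.funext fun v => by rw [hall, map_zero])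
  rw [map_mul, eval_X] at hv
  have hv1 : v 1 ≠ 0 := right_ne_zero_of_mul hv
  refine ⟨v 0 / v 1, fun hzero => left_ne_zero_of_mul hv ?_⟩
  have hvv : v = v 1 • ![v 0 / v 1, 1] := by
    ext i
    fin_cases i
    · simp [mul_div_cancel₀ _ hv1]
    · simp
  rw [hvv, h.eval_smul_eq, hzero, mul_zero]

/-- The substitution `x ↦ x + a y`, with values in polynomials in `y` over polynomials in `x`. -/
noncomputable def shearEquiv (a : ℂ) : MvPolynomial (Fin 2) ℂ ≃ₐ[ℂ] Polynomial (Polynomial ℂ) :=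
  AlgEquiv.ofAlgHom
    (aeval ![Polynomial.C Polynomial.X + Polynomial.C (Polynomial.C a) * Polynomial.X,
      Polynomial.X])
    (Polynomial.aevalAeval (X 0 - C a * X 1) (X 1))
    (by
      ext
      · simp
      · simp)
    (by
      ext i
      fin_cases i
      · simp
      · simp)

theorem shearEquiv_apply (a : ℂ) (f : MvPolynomial (Fin 2) ℂ) :
    shearEquiv a f = aeval ![Polynomial.C Polynomial.X +
      Polynomial.C (Polynomial.C a) * Polynomial.X, Polynomial.X] f := rfl

theorem evalEval_shearEquiv (a x y : ℂ) (f : MvPolynomial (Fin 2) ℂ) :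
    (shearEquiv a f).evalEval x y = eval ![x + a * y, y] f := by
  have : (Polynomial.evalEvalRingHom x y).comp (shearEquiv a : _ →+* _) =
      eval ![x + a * y, y] := by
    ext i
    · simp [shearEquiv_apply, Polynomial.algebraMap_apply]
    · fin_cases i <;> simp [shearEquiv_apply]
  exact congrArg (fun φ => φ f) this

theorem squarefree_shearEquiv (a : ℂ) {f : MvPolynomial (Fin 2) ℂ} (hf : Squarefree f) :
    Squarefree (shearEquiv a f) := fun x hx => by
  have h := map_dvd (shearEquiv a).symm hx
  rw [map_mul, AlgEquiv.symm_apply_apply] at h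
  simpa using (hf _ h).map (shearEquiv a)

theorem natDegree_shearEquiv_le (a : ℂ) {f : MvPolynomial (Fin 2) ℂ} {n : ℕ}
    (hf : f.totalDegree ≤ n) : (shearEquiv a f).natDegree ≤ n ∧
      (shearEquiv a f).coeff n = Polynomial.C (eval ![a, 1] (homogeneousComponent n f)) := by
  set ℓ : Polynomial (Polynomial ℂ) :=
    Polynomial.C Polynomial.X + Polynomial.C (Polynomial.C a) * Polynomial.X with hℓ
  have hℓdeg : ℓ.natDegree ≤ 1 := by rw [hℓ]; compute_degree
  have hℓcoeff : ℓ.coeff 1 = Polynomial.C a := by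
    rw [hℓ]
    simp [Polynomial.coeff_C]
  have hterm : ∀ s : Fin 2 →₀ ℕ, ∀ c : ℂ,
      shearEquiv a (monomial s c) = Polynomial.C (Polynomial.C c) * (ℓ ^ s 0 * Polynomial.X ^ s 1) :=
    fun s c => by
      rw [shearEquiv_apply, aeval_monomial, Finsupp.prod_fintype _ _ (fun _ => pow_zero _)]
      simp [Polynomial.algebraMap_apply, hℓ]
  have hdeg : ∀ s : Fin 2 →₀ ℕ, s.degree = s 0 + s 1 := fun s => by
    rw [Finsupp.degree_eq_sum]; simp
  have hpow : ∀ k, (ℓ ^ k).natDegree ≤ k := fun k => by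
    simpa using Polynomial.natDegree_pow_le_of_le k hℓdeg
  have htermdeg : ∀ s : Fin 2 →₀ ℕ, ∀ c : ℂ,
      (shearEquiv a (monomial s c)).natDegree ≤ s.degree := fun s c => by
    rw [hterm, hdeg]
    refine (Polynomial.natDegree_C_mul_le _ _).trans (Polynomial.natDegree_mul_le_of_le (hpow _) ?_)
    exact Polynomial.natDegree_X_pow_le _
  have htermcoeff : ∀ s : Fin 2 →₀ ℕ, ∀ c : ℂ,
      (shearEquiv a (monomial s c)).coeff s.degree = Polynomial.C (eval ![a, 1] (monomial s c)) :=
    fun s c => by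
      rw [hterm, hdeg, Polynomial.coeff_C_mul, Polynomial.coeff_mul_add_eq_of_natDegree_le
        (hpow _) (Polynomial.natDegree_X_pow_le _), Polynomial.coeff_X_pow_self, eval_monomial,
        Finsupp.prod_fintype _ _ (fun _ => pow_zero _)]
      have := Polynomial.coeff_pow_of_natDegree_le (m := s 0) hℓdeg
      rw [mul_one] at this
      rw [this, hℓcoeff]
      simp
  have hle : ∀ s ∈ f.support, s.degree ≤ n := fun s hs => (le_totalDegree hs).trans hf
  have hsum : shearEquiv a f = ∑ s ∈ f.support, shearEquiv a (monomial s (coeff s f)) := by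
    rw [← map_sum, support_sum_monomial_coeff]
  constructor
  · rw [hsum]
    exact Polynomial.natDegree_sum_le_of_forall_le _ _ fun s hs => (htermdeg _ _).trans (hle s hs)
  · rw [hsum, Polynomial.finsetSum_coeff, homogeneousComponent_apply, map_sum, map_sum,
      Finset.sum_filter]
    refine Finset.sum_congr rfl fun s hs => ?_
    split_ifs with h
    · rw [← h, htermcoeff]
    · exact Polynomial.coeff_eq_zero_of_natDegree_lt
        ((htermdeg _ _).trans_lt (lt_of_le_of_ne (hle s hs) h))

/-- The polynomial function of `f` in the coordinates `(x - a y, y)`. -/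
noncomputable def shearEval (a : ℂ) (f : MvPolynomial (Fin 2) ℂ) (p : ℂ × ℂ) : ℂ :=
  eval ![p.1 + a * p.2, p.2] f

theorem eval_map_shearEquiv (a x y : ℂ) (f : MvPolynomial (Fin 2) ℂ) :
    ((shearEquiv a f).map (Polynomial.evalRingHom x)).eval y = shearEval a f (x, y) := by
  rw [Polynomial.map_evalRingHom_eval, evalEval_shearEquiv]
  rfl

theorem contDiff_shearEval (a : ℂ) (f : MvPolynomial (Fin 2) ℂ) :
    ContDiff ℂ 1 (shearEval a f) := by
  have h : ContDiff ℂ 1 fun p : ℂ × ℂ => ∑ s ∈ f.support, coeff s f *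
      ∏ i ∈ s.support, (![p.1 + a * p.2, p.2] : Fin 2 → ℂ) i ^ s i :=
    ContDiff.sum fun s _ => contDiff_const.mul (contDiff_prod fun i _ => ContDiff.pow (by
      fin_cases i
      · exact contDiff_fst.add (contDiff_const.mul contDiff_snd)
      · exact contDiff_snd) _)
  exact h

theorem shearEval_smul (a : ℂ) {f : MvPolynomial (Fin 2) ℂ} {n : ℕ} (h : f.IsHomogeneous n)
    (t : ℂ) (p : ℂ × ℂ) : shearEval a f (t • p) = t ^ n * shearEval a f p := by
  rw [shearEval, shearEval, ← h.eval_smul_eq]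
  congr 2
  ext i
  fin_cases i
  · simp [mul_add, mul_left_comm]
  · simp

theorem fderiv_shearEval_apply (a x y : ℂ) (f : MvPolynomial (Fin 2) ℂ) :
    fderiv ℂ (shearEval a f) (x, y) (0, 1) =
      (((shearEquiv a f).map (Polynomial.evalRingHom x)).derivative).eval y := by
  have h1 : HasDerivAt (fun t : ℂ => (x, t)) (0, 1) y :=
    (hasDerivAt_const y x).prodMk (hasDerivAt_id y)
  have h2 := ((contDiff_shearEval a f).differentiable one_ne_zero (x, y)).hasFDerivAt.comp_hasDerivAt
    y h1
  refine h2.unique ?_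
  refine (((shearEquiv a f).map (Polynomial.evalRingHom x)).hasDerivAt y).congr_of_eventuallyEq
    (Eventually.of_forall fun t => ?_)
  exact (eval_map_shearEquiv a x t f).symm

/-- In suitable coordinates a plane curve of degree `d` has `d` points, all simple, on every
vertical line sufficiently far away. -/
theorem exists_fibers_shearEval {a : ℂ} {f : MvPolynomial (Fin 2) ℂ} (hf : Squarefree f)
    (ha : eval ![a, 1] (homogeneousComponent f.totalDegree f) ≠ 0) :
    ∃ R : ℝ, (∀ x, R < ‖x‖ → {y | shearEval a f (x, y) = 0}.encard = f.totalDegree) ∧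
      ∀ x y, R < ‖x‖ → shearEval a f (x, y) = 0 →
        fderiv ℂ (shearEval a f) (x, y) (0, 1) ≠ 0 := by
  set d := f.totalDegree
  set c := eval ![a, 1] (homogeneousComponent d f)
  obtain ⟨hdeg, hcoeff⟩ := natDegree_shearEquiv_le a (f := f) (n := d) le_rfl
  have hcc : c⁻¹ * c = 1 := inv_mul_cancel₀ ha
  set P := Polynomial.C (Polynomial.C c⁻¹) * shearEquiv a f with hP
  have hfP : shearEquiv a f = Polynomial.C (Polynomial.C c) * P := by
    rw [hP, ← mul_assoc, ← Polynomial.C_mul, ← Polynomial.C_mul, mul_comm c, hcc,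
      Polynomial.C_1, Polynomial.C_1, one_mul]
  have hPc : P.coeff d = 1 := by
    rw [hP, Polynomial.coeff_C_mul, hcoeff, ← Polynomial.C_mul, hcc, Polynomial.C_1]
  have hPle : P.natDegree ≤ d := (Polynomial.natDegree_C_mul_le _ _).trans hdeg
  have hPm : P.Monic := Polynomial.monic_of_natDegree_le_of_coeff_eq_one d hPle hPc
  have hPd : P.natDegree = d :=
    le_antisymm hPle (Polynomial.le_natDegree_of_ne_zero (by rw [hPc]; exact one_ne_zero))
  obtain ⟨w, hw0, hw⟩ := hPm.exists_separable_map_evalRingHom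
    ((squarefree_shearEquiv a hf).squarefree_of_dvd (Dvd.intro_left _ hfP.symm))
  obtain ⟨R, hR⟩ := (w.roots.toFinset.finite_toSet.isBounded).exists_norm_le
  have hsep : ∀ x, R < ‖x‖ → (P.map (Polynomial.evalRingHom x)).Separable := fun x hx =>
    hw x fun h => hx.not_ge (hR x (by simpa [hw0] using h))
  have hroot : ∀ x y, shearEval a f (x, y) = 0 ↔
      (P.map (Polynomial.evalRingHom x)).eval y = 0 := fun x y => by
    have : shearEval a f (x, y) = c * (P.map (Polynomial.evalRingHom x)).eval y := by
      rw [← eval_map_shearEquiv, hfP]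
      simp
    rw [this, mul_eq_zero, or_iff_right ha]
  refine ⟨R, fun x hx => ?_, fun x y hx hy => ?_⟩
  · have hset : {y | shearEval a f (x, y) = 0} =
        ((P.map (Polynomial.evalRingHom x)).roots.toFinset : Set ℂ) := by
      ext y
      simp [hroot, (hPm.map (Polynomial.evalRingHom x)).ne_zero]
    rw [hset, Set.encard_coe_eq_coe_finsetCard,
      Multiset.toFinset_card_of_nodup (Polynomial.nodup_roots (hsep x hx)),
      ← (IsAlgClosed.splits _).natDegree_eq_card_roots, hPm.natDegree_map, hPd]
  · rw [fderiv_shearEval_apply, hfP]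
    have h := (hsep x hx).eval₂_derivative_ne_zero (RingHom.id ℂ) ((hroot x y).1 hy)
    rw [Polynomial.eval₂_id] at h
    simpa [ha] using h

theorem shearEval_eq_sum (a : ℂ) (f : MvPolynomial (Fin 2) ℂ) (p : ℂ × ℂ) :
    shearEval a f p =
      ∑ k ∈ Finset.range (f.totalDegree + 1), shearEval a (homogeneousComponent k f) p := by
  simp only [shearEval, ← map_sum, sum_homogeneousComponent]

/-- A form which does not vanish on the line `x = 0` vanishes on finitely many other lines. -/
theorem exists_finite_slopes {a : ℂ} {φ : MvPolynomial (Fin 2) ℂ} {n : ℕ}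
    (h : φ.IsHomogeneous n) (ha : eval ![a, 1] φ ≠ 0) :
    ∃ A : Finset ℂ, ∀ p : ℂ × ℂ, p ≠ 0 → shearEval a φ p = 0 → ∃ α ∈ A, p.2 = α * p.1 := by
  set Q := (shearEquiv a φ).map (Polynomial.evalRingHom 1)
  have hQ : Q ≠ 0 := by
    have hc := (natDegree_shearEquiv_le a h.totalDegree_le).2
    rw [homogeneousComponent_of_mem h, if_pos rfl] at hc
    intro h0
    have := congrArg (fun q => q.coeff n) h0
    simp only [Q, Polynomial.coeff_map, hc] at this
    exact ha (by simpa using this)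
  refine ⟨Q.roots.toFinset, fun p hp hzero => ?_⟩
  have hp1 : p.1 ≠ 0 := by
    intro hp1
    have hp2 : p.2 ≠ 0 := fun hp2 => hp (Prod.ext hp1 hp2)
    have hpe : p = p.2 • ((0, 1) : ℂ × ℂ) := Prod.ext (by simp [hp1]) (by simp)
    rw [hpe, shearEval_smul a h, mul_eq_zero] at hzero
    exact hzero.elim (pow_ne_zero _ hp2) fun h => ha (by simpa [shearEval] using h)
  refine ⟨p.2 / p.1, ?_, (div_mul_cancel₀ _ hp1).symm⟩
  have hpe : p = p.1 • ((1, p.2 / p.1) : ℂ × ℂ) :=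
    Prod.ext (by simp) (by simp [mul_div_cancel₀ _ hp1])
  rw [hpe, shearEval_smul a h, mul_eq_zero, or_iff_right (pow_ne_zero _ hp1)] at hzero
  rw [Multiset.mem_toFinset, Polynomial.mem_roots hQ, Polynomial.IsRoot.def, eval_map_shearEquiv]
  exact hzero

theorem exists_asymptoticToLines_shearEval {a : ℂ} {f : MvPolynomial (Fin 2) ℂ}
    (ha : eval ![a, 1] (homogeneousComponent f.totalDegree f) ≠ 0) :
    ∃ A : Finset ℂ, AsymptoticToLines {p | shearEval a f p = 0} A := by
  set d := f.totalDegree with hd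
  have hhom := fun k => homogeneousComponent_isHomogeneous k f
  obtain ⟨A, hA⟩ := exists_finite_slopes (hhom d) ha
  have hcont : ∀ k, Continuous (shearEval a (homogeneousComponent k f)) :=
    fun k => (contDiff_shearEval a _).continuous
  refine ⟨A, fun δ hδ => ?_⟩
  have hK : IsCompact (Metric.sphere (0 : ℂ × ℂ) 1 ∩ ⋂ α ∈ A, {p | δ ≤ ‖p.2 - α * p.1‖}) :=
    (isCompact_sphere _ _).inter_right (isClosed_biInter fun α _ =>
      isClosed_le continuous_const (by fun_prop))
  obtain ⟨κ, hκ, hκle⟩ := hK.exists_forall_le' (f := fun p =>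
    ‖shearEval a (homogeneousComponent d f) p‖) (hcont d).norm.continuousOn (a := 0) fun p hp => by
      refine norm_pos_iff.2 fun hzero => ?_
      obtain ⟨α, hα, hpα⟩ := hA p (Metric.ne_of_mem_sphere hp.1 one_ne_zero) hzero
      have := Set.mem_iInter₂.1 hp.2 α hα
      simp only [hpα, sub_self, norm_zero, Set.mem_ofPred_eq] at this
      exact hδ.not_ge this
  have hbound : ∀ k, ∃ C, ∀ u ∈ Metric.sphere (0 : ℂ × ℂ) 1,
      ‖shearEval a (homogeneousComponent k f) u‖ ≤ C :=
    fun k => (isCompact_sphere _ _).exists_bound_of_continuousOn (hcont k).continuousOn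
  choose C hC using hbound
  set M := ∑ k ∈ Finset.range d, C k
  refine ⟨max 1 (M / κ + 1), fun p hp hN => ?_⟩
  by_contra! hfar
  have hn1 : 1 ≤ ‖p‖ := (le_max_left _ _).trans hN
  have hn0 : 0 < ‖p‖ := one_pos.trans_le hn1
  have hnM : M < ‖p‖ * κ := (div_lt_iff₀ hκ).1
    ((lt_add_one _).trans_le ((le_max_right _ _).trans hN))
  have hn0' : (‖p‖ : ℂ) ≠ 0 := Complex.ofReal_ne_zero.2 hn0.ne'
  set u : ℂ × ℂ := (‖p‖ : ℂ)⁻¹ • p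
  have hpu : p = (‖p‖ : ℂ) • u := (smul_inv_smul₀ hn0' p).symm
  have hu : u ∈ Metric.sphere (0 : ℂ × ℂ) 1 := by
    rw [mem_sphere_zero_iff_norm, norm_smul, norm_inv, Complex.norm_real, norm_norm,
      inv_mul_cancel₀ hn0.ne']
  have hterm : ∀ k, ‖shearEval a (homogeneousComponent k f) p‖ =
      ‖p‖ ^ k * ‖shearEval a (homogeneousComponent k f) u‖ := fun k => by
    conv_lhs => rw [hpu]
    rw [shearEval_smul a (hhom k), norm_mul, norm_pow, Complex.norm_real, norm_norm]
  have huK : κ ≤ ‖shearEval a (homogeneousComponent d f) u‖ := by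
    refine hκle u ⟨hu, Set.mem_iInter₂.2 fun α hα => ?_⟩
    have h1 := hfar α hα
    have h2 : p.2 - α * p.1 = (‖p‖ : ℂ) * (u.2 - α * u.1) := by
      conv_lhs => rw [hpu]
      simp only [Prod.smul_fst, Prod.smul_snd, smul_eq_mul]
      ring
    rw [h2, norm_mul, Complex.norm_real, norm_norm, mul_comm] at h1
    exact (lt_of_mul_lt_mul_left h1 hn0.le).le
  have hsum := shearEval_eq_sum a f p
  rw [show shearEval a f p = 0 from hp, Finset.sum_range_succ, ← hd] at hsum
  have htop : ‖shearEval a (homogeneousComponent d f) p‖ ≤ ∑ k ∈ Finset.range d, ‖p‖ ^ k * C k := by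
    rw [← norm_neg, ← eq_neg_of_add_eq_zero_left hsum.symm]
    refine (norm_sum_le _ _).trans (Finset.sum_le_sum fun k _ => ?_)
    rw [hterm]
    exact mul_le_mul_of_nonneg_left (hC k u hu) (by positivity)
  have hCnn : ∀ k, 0 ≤ C k := fun k => (norm_nonneg _).trans (hC k u hu)
  have hM : ‖p‖ * ∑ k ∈ Finset.range d, ‖p‖ ^ k * C k ≤ ‖p‖ ^ d * M := by
    rw [Finset.mul_sum, Finset.mul_sum]
    refine Finset.sum_le_sum fun k hk => ?_
    rw [← mul_assoc, ← pow_succ']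
    exact mul_le_mul_of_nonneg_right
      (pow_le_pow_right₀ hn1 (Finset.mem_range.1 hk)) (hCnn k)
  rw [hterm] at htop
  have hpos : 0 < ‖p‖ ^ d := by positivity
  have h1 : ‖p‖ * (‖p‖ ^ d * κ) ≤ ‖p‖ ^ d * M :=
    (mul_le_mul_of_nonneg_left ((mul_le_mul_of_nonneg_left huK hpos.le).trans htop) hn0.le).trans hM
  have h2 := mul_lt_mul_of_pos_left hnM hpos
  linarith

theorem MvPolynomial.homogeneousComponent_totalDegree_ne_zero {σ R : Type*} [CommSemiring R]
    {f : MvPolynomial σ R} (hf : f ≠ 0) : homogeneousComponent f.totalDegree f ≠ 0 := by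
  obtain ⟨s, hs, hdeg⟩ : ∃ s ∈ f.support, f.totalDegree = s.degree :=
    f.support.exists_mem_eq_sup (support_nonempty.2 hf) Finsupp.degree
  intro h
  have hc := congrArg (coeff s) h
  rw [coeff_homogeneousComponent, if_pos hdeg.symm, coeff_zero] at hc
  exact mem_support_iff.1 hs hc

/-- The linear change of coordinates `(u, v) ↦ (u - a v, v)` of the plane. -/
noncomputable def shearCoordinates (a : ℂ) : EuclideanSpace ℂ (Fin 2) ≃L[ℂ] ℂ × ℂ :=
  LinearEquiv.toContinuousLinearEquiv
    { toFun := fun z => (z 0 - a * z 1, z 1)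
      invFun := fun p => !₂[p.1 + a * p.2, p.2]
      map_add' := fun z w => Prod.ext (by simp; ring) (by simp)
      map_smul' := fun t z => Prod.ext (by simp; ring) (by simp)
      left_inv := fun z => by
        ext i
        fin_cases i <;> simp
      right_inv := fun p => by simp }

theorem image_shearCoordinates_mvZeroSet (a : ℂ) (f : MvPolynomial (Fin 2) ℂ) :
    shearCoordinates a '' mvZeroSet f = {p | shearEval a f p = 0} := by
  rw [ContinuousLinearEquiv.image_eq_preimage_symm]
  rfl

theorem exists_sheetSystem_image_mvZeroSet {f : MvPolynomial (Fin 2) ℂ} (hf : Squarefree f) :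
    ∃ a, Nonempty (SheetSystem (shearCoordinates a '' mvZeroSet f) f.totalDegree) := by
  have htop : homogeneousComponent f.totalDegree f ≠ 0 :=
    homogeneousComponent_totalDegree_ne_zero hf.ne_zero
  obtain ⟨a, ha⟩ := (homogeneousComponent_isHomogeneous f.totalDegree f).exists_eval_ne_zero htop
  obtain ⟨A, hA⟩ := exists_asymptoticToLines_shearEval ha
  obtain ⟨R, hcard, hder⟩ := exists_fibers_shearEval hf ha
  refine ⟨a, ?_⟩
  rw [image_shearCoordinates_mvZeroSet]
  exact hA.nonempty_sheetSystem (contDiff_shearEval a f) hcard hder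

theorem OuterBiLipAtInfty.totalDegree_le {f g : MvPolynomial (Fin 2) ℂ} (hf : Squarefree f)
    (hg : Squarefree g) (h : OuterBiLipAtInfty (mvZeroSet f) (mvZeroSet g)) :
    f.totalDegree ≤ g.totalDegree := by
  obtain ⟨a, ⟨T⟩⟩ := exists_sheetSystem_image_mvZeroSet hf
  obtain ⟨b, ⟨U⟩⟩ := exists_sheetSystem_image_mvZeroSet hg
  obtain ⟨φ, ψ, L, R, hφ⟩ := ((h.symm.image_right (shearCoordinates a)).symm.image_right
    (shearCoordinates b)).exists_biLipOutsideBall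
  exact T.le_of_biLipOutsideBall U hφ

/-- the degree of complex affine plane curves is an outer bi-Lipschitz
invariant at infinity. -/
theorem degree_curves_biLipschitz_invariant_at_infinity
    (f g : MvPolynomial (Fin 2) ℂ)
    (hfdeg : 0 < f.totalDegree) (hgdeg : 0 < g.totalDegree)
    (hfsqf : Squarefree f) (hgsqf : Squarefree g)
    (hbilip : OuterBiLipAtInfty (mvZeroSet f) (mvZeroSet g)) :
    f.totalDegree = g.totalDegree :=
  le_antisymm (hbilip.totalDegree_le hfsqf hgsqf) (hbilip.symm.totalDegree_le hgsqf hfsqf)
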